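/- arXiv:1007.2460 — 5 statements merged into one kernel-verified Lean document; each statement's English description precedes it below -/
import Mathlib

section
/- Let w ∈ ℂ, and let ρ0 and ρw be the isometries of ℂ given by ρ0(z) = i·z and ρw(z) = i·(z − w) + w (rotations by π/2 about 0 and about w). An isometry f of ℂ belongs to the subgroup of the isometry group of ℂ generated by ρ0 and ρw if and only if there exist k ∈ {0, 1, 2, 3} and integers a, b such that f(z) = i^k · z + (1 − i)·w·(a + b·i) for all z ∈ ℂ. -/
open Complex

lemma p4_rot (n : ℕ) (a b : ℤ) :
    ∃ c d : ℤ, I ^ n * ((a : ℂ) + (b : ℂ) * I) = (c : ℂ) + (d : ℂ) * I := by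
  induction n with
  | zero => exact ⟨a, b, by simp⟩
  | succ n ih =>
    obtain ⟨c, d, h⟩ := ih
    refine ⟨-d, c, ?_⟩
    rw [pow_succ', mul_assoc, h]
    push_cast
    linear_combination (d : ℂ) * I_mul_I

lemma p4_forward (w : ℂ) (ρ0 ρw : ℂ ≃ᵢ ℂ)
    (h0 : ∀ z : ℂ, ρ0 z = I * z)
    (hw : ∀ z : ℂ, ρw z = I * (z - w) + w)
    (f : ℂ ≃ᵢ ℂ) (hf : f ∈ Subgroup.closure {ρ0, ρw}) :
      ∃ n : ℕ, ∃ a b : ℤ,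
        ∀ z : ℂ, f z = I ^ n * z + (1 - I) * w * ((a : ℂ) + (b : ℂ) * I) := by
  induction hf using Subgroup.closure_induction with
  | mem x hx =>
    rcases hx with rfl | rfl
    · exact ⟨1, 0, 0, fun z => by simp [h0]⟩
    · exact ⟨1, 1, 0, fun z => by rw [hw]; push_cast; ring⟩
  | one => exact ⟨0, 0, 0, fun z => by simp⟩
  | mul x y _ _ hx hy =>
    obtain ⟨n, a, b, hx⟩ := hx
    obtain ⟨m, c, d, hy⟩ := hy
    obtain ⟨cc, dd, h⟩ := p4_rot n c d
    refine ⟨n + m, a + cc, b + dd, fun z => ?_⟩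
    rw [IsometryEquiv.mul_apply, hx, hy]
    push_cast
    linear_combination (1 - I) * w * h
  | inv x _ hx =>
    obtain ⟨n, a, b, hx⟩ := hx
    obtain ⟨c, d, h⟩ := p4_rot (3 * n) a b
    refine ⟨3 * n, -c, -d, fun z => ?_⟩
    apply x.injective
    rw [IsometryEquiv.apply_inv_self, hx]
    have h4 : I ^ n * I ^ (3 * n) = 1 := by
      rw [← pow_add, show n + 3 * n = 4 * n by ring, pow_mul, I_pow_four, one_pow]
    push_cast
    linear_combination (-z + (1 - I) * w * (a + b * I)) * h4 - I ^ n * (1 - I) * w * h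

lemma p4_trans_pow (T : ℂ ≃ᵢ ℂ) (c : ℂ) (hT : ∀ z, T z = z + c) (a : ℤ) :
    ∀ z, (T ^ a) z = z + a * c := by
  induction a using Int.induction_on with
  | zero => simp
  | succ i ih =>
    intro z
    rw [zpow_add_one, IsometryEquiv.mul_apply, ih, hT]
    push_cast; ring
  | pred i ih =>
    intro z
    have hi : T⁻¹ z = z - c := by
      apply T.injective
      rw [IsometryEquiv.apply_inv_self, hT]; ring
    rw [zpow_sub_one, IsometryEquiv.mul_apply, ih, hi]
    push_cast; ring

lemma p4_rot_pow (T : ℂ ≃ᵢ ℂ) (hT : ∀ z, T z = I * z) (n : ℕ) :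
    ∀ z, (T ^ n) z = I ^ n * z := by
  induction n with
  | zero => simp
  | succ i ih =>
    intro z
    rw [pow_succ, IsometryEquiv.mul_apply, ih, hT]
    ring

/-- The p4 group generated by the π/2-rotations about `0` and about `w` consists
exactly of the isometries `z ↦ i^k z + (1 - i) w (a + b i)` with `k ∈ {0,1,2,3}`,
`a b ∈ ℤ`. -/
theorem mem_p4_closure_iff (w : ℂ) (ρ0 ρw : ℂ ≃ᵢ ℂ)
    (h0 : ∀ z : ℂ, ρ0 z = I * z)
    (hw : ∀ z : ℂ, ρw z = I * (z - w) + w)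
    (f : ℂ ≃ᵢ ℂ) :
    f ∈ Subgroup.closure {ρ0, ρw} ↔
      ∃ k : Fin 4, ∃ a b : ℤ,
        ∀ z : ℂ, f z = I ^ (k : ℕ) * z + (1 - I) * w * ((a : ℂ) + (b : ℂ) * I) := by
  constructor
  · intro hf
    obtain ⟨n, a, b, h⟩ := p4_forward w ρ0 ρw h0 hw f hf
    refine ⟨⟨n % 4, Nat.mod_lt _ (by norm_num)⟩, a, b, fun z => ?_⟩
    rw [h, I_pow_eq_pow_mod n]
  · rintro ⟨k, a, b, h⟩
    have m0 : ρ0 ∈ Subgroup.closure {ρ0, ρw} := Subgroup.subset_closure (by simp)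
    have mw : ρw ∈ Subgroup.closure {ρ0, ρw} := Subgroup.subset_closure (by simp)
    have hi : ∀ z, ρ0⁻¹ z = -I * z := by
      intro z
      apply ρ0.injective
      rw [IsometryEquiv.apply_inv_self, h0]
      linear_combination z * I_mul_I
    have h1 : ∀ z, (ρw * ρ0⁻¹) z = z + (1 - I) * w := by
      intro z
      rw [IsometryEquiv.mul_apply, hw, hi]
      linear_combination -z * I_mul_I
    have h2 : ∀ z, (ρ0 * (ρw * ρ0⁻¹) * ρ0⁻¹) z = z + I * ((1 - I) * w) := by
      intro z
      rw [IsometryEquiv.mul_apply, IsometryEquiv.mul_apply, h1, h0, hi]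
      linear_combination -z * I_mul_I
    have hf : f = (ρw * ρ0⁻¹) ^ a * (ρ0 * (ρw * ρ0⁻¹) * ρ0⁻¹) ^ b * ρ0 ^ (k : ℕ) := by
      ext1 z
      rw [IsometryEquiv.mul_apply, IsometryEquiv.mul_apply, p4_trans_pow _ _ h1,
        p4_trans_pow _ _ h2, p4_rot_pow _ h0, h]
      ring
    have m1 := mul_mem mw (inv_mem m0)
    rw [hf]
    exact mul_mem (mul_mem (zpow_mem m1 a)
      (zpow_mem (mul_mem (mul_mem m0 m1) (inv_mem m0)) b)) (pow_mem m0 _)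
end

section
/- Let w ∈ ℂ, ρ0(z) = i·z, ρw(z) = i·(z − w) + w, and let G be the subgroup of the isometry group of ℂ generated by ρ0 and ρw. A complex number c has the property that the translation z ↦ z + c belongs to G if and only if c = (1 − i)·w·(a + b·i) for some integers a, b. (That is, the translation lattice of the p4 group generated by π/2-rotations about 0 and w is (1 − i)·w·ℤ[i].) -/
open Complex

lemma zpow_translation (T : ℂ ≃ᵢ ℂ) (t : ℂ) (hT : ∀ z, T z = z + t) (n : ℤ) :
    ∀ z, (T ^ n) z = z + n * t := by
  have hinv : ∀ z, T⁻¹ z = z - t := by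
    intro z
    apply T.injective
    rw [IsometryEquiv.apply_inv_self, hT]
    ring
  induction n using Int.induction_on with
  | zero => intro z; simp
  | succ k ih =>
    intro z
    rw [zpow_add_one, IsometryEquiv.mul_apply, ih, hT]
    push_cast
    ring
  | pred k ih =>
    intro z
    rw [zpow_sub_one, IsometryEquiv.mul_apply, ih, hinv]
    push_cast
    ring

/-- The translation lattice of the p4 group generated by the π/2-rotations about `0`
and about `w` is `(1 - i)·w·ℤ[i]`: the translation `z ↦ z + c` lies in the group iff
`c = (1 - i) w (a + b i)` for some integers `a`, `b`. -/
theorem translation_mem_p4_closure_iff (w : ℂ) (ρ0 ρw : ℂ ≃ᵢ ℂ)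
    (h0 : ∀ z : ℂ, ρ0 z = I * z)
    (hw : ∀ z : ℂ, ρw z = I * (z - w) + w)
    (c : ℂ) :
    (∃ f ∈ Subgroup.closure {ρ0, ρw}, ∀ z : ℂ, f z = z + c) ↔
      ∃ a b : ℤ, c = (1 - I) * w * ((a : ℂ) + (b : ℂ) * I) := by
  constructor
  · rintro ⟨f, hf, hfc⟩
    have key : ∃ p q a b : ℤ, p ^ 2 + q ^ 2 = 1 ∧
        ∀ z : ℂ, f z = (p + q * I) * z + (1 - I) * w * (a + b * I) := by
      clear hfc
      induction hf using Subgroup.closure_induction with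
      | mem x hx =>
        rcases hx with rfl | hx
        · exact ⟨0, 1, 0, 0, by norm_num, fun z => by rw [h0]; push_cast; ring⟩
        · rw [Set.mem_singleton_iff] at hx
          subst hx
          exact ⟨0, 1, 1, 0, by norm_num, fun z => by rw [hw]; push_cast; ring⟩
      | one => exact ⟨1, 0, 0, 0, by norm_num, fun z => by simp⟩
      | mul x y _ _ hx hy =>
        obtain ⟨p, q, a, b, h1, hx⟩ := hx
        obtain ⟨p', q', a', b', h2, hy⟩ := hy
        refine ⟨p * p' - q * q', p * q' + q * p', p * a' - q * b' + a, p * b' + q * a' + b,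
          ?_, fun z => ?_⟩
        · linear_combination (p' ^ 2 + q' ^ 2) * h1 + h2
        · rw [IsometryEquiv.mul_apply, hx, hy]
          push_cast
          linear_combination (q * q' * z + (1 - I) * w * q * b') * I_sq
      | inv x _ hx =>
        obtain ⟨p, q, a, b, h1, hx⟩ := hx
        refine ⟨p, -q, -(p * a + q * b), -(p * b - q * a), by linear_combination h1,
          fun z => ?_⟩
        apply x.injective
        rw [IsometryEquiv.apply_inv_self, hx]
        have h1' : (p : ℂ) ^ 2 + (q : ℂ) ^ 2 = 1 := by exact_mod_cast h1
        push_cast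
        have e : ((p : ℂ) + q * I) * (p - q * I) = 1 := by
          linear_combination h1' - (q : ℂ) ^ 2 * I_sq
        have e2 : -((p : ℂ) * a + q * b) + -(p * b - q * a) * I
            = -((p - q * I) * (a + b * I)) := by
          linear_combination -(q : ℂ) * b * I_sq
        rw [e2]
        linear_combination (-z + (1 - I) * w * (a + b * I)) * e
    obtain ⟨p, q, a, b, -, h⟩ := key
    refine ⟨a, b, ?_⟩
    have h2 := h 0
    rw [hfc] at h2
    simpa using h2
  · rintro ⟨a, b, rfl⟩
    have m0 : ρ0 ∈ Subgroup.closure {ρ0, ρw} := Subgroup.subset_closure (by simp)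
    have mw : ρw ∈ Subgroup.closure {ρ0, ρw} := Subgroup.subset_closure (by simp)
    have hinv : ∀ z, ρ0⁻¹ z = -I * z := by
      intro z
      apply ρ0.injective
      rw [IsometryEquiv.apply_inv_self, h0]
      linear_combination z * I_sq
    have hT : ∀ z, (ρw * ρ0⁻¹) z = z + (1 - I) * w := by
      intro z
      rw [IsometryEquiv.mul_apply, hw, hinv]
      linear_combination -z * I_sq
    have hS : ∀ z, (ρ0 * (ρw * ρ0⁻¹) * ρ0⁻¹) z = z + I * (1 - I) * w := by
      intro z
      rw [IsometryEquiv.mul_apply, IsometryEquiv.mul_apply, hT, hinv, h0]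
      linear_combination -z * I_sq
    have mT := mul_mem mw (inv_mem m0)
    have mS := mul_mem (mul_mem m0 mT) (inv_mem m0)
    refine ⟨_, mul_mem (zpow_mem mT a) (zpow_mem mS b), fun z => ?_⟩
    rw [IsometryEquiv.mul_apply, zpow_translation _ _ hT, zpow_translation _ _ hS]
    ring
end

section
/- Let ω = exp(2πi/3), let w ∈ ℂ, and let ρ0(z) = ω·z and ρw(z) = ω·(z − w) + w be the rotations of ℂ by 2π/3 about 0 and about w. A complex number c has the property that the translation z ↦ z + c belongs to the subgroup of the isometry group of ℂ generated by ρ0 and ρw if and only if c = (1 − ω)·w·(a + b·ω) for some integers a, b. (That is, the translation lattice of this p3 group is (1 − ω)·w·ℤ[ω].) -/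
open Complex

/-- The translation lattice of the p3 group generated by the 2π/3-rotations about `0`
and about `w` is `(1 - ω)·w·ℤ[ω]`, where `ω = exp(2πi/3)`: the translation `z ↦ z + c`
lies in the group iff `c = (1 - ω) w (a + b ω)` for some integers `a`, `b`. -/
theorem translation_mem_p3_closure_iff (ω : ℂ) (hω : ω = Complex.exp (2 * Real.pi * I / 3))
    (w : ℂ) (ρ0 ρw : ℂ ≃ᵢ ℂ)
    (h0 : ∀ z : ℂ, ρ0 z = ω * z)
    (hw : ∀ z : ℂ, ρw z = ω * (z - w) + w)
    (c : ℂ) :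
    (∃ f ∈ Subgroup.closure {ρ0, ρw}, ∀ z : ℂ, f z = z + c) ↔
      ∃ a b : ℤ, c = (1 - ω) * w * ((a : ℂ) + (b : ℂ) * ω) := by
  have h3 : ω ^ 3 = 1 := by
    rw [hω, ← Complex.exp_nat_mul, ← Complex.exp_two_pi_mul_I]
    congr 1
    push_cast
    ring
  have hne : ω ≠ 1 := by
    intro h
    rw [hω, Complex.exp_eq_one_iff] at h
    obtain ⟨n, hn⟩ := h
    have hpi : (2 * Real.pi * I : ℂ) ≠ 0 := Complex.two_pi_I_ne_zero
    have h1 : (2 * Real.pi * I : ℂ) * (3 * n) = (2 * Real.pi * I : ℂ) * 1 := by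
      linear_combination (-3) * hn
    have h2 := mul_left_cancel₀ hpi h1
    have h4 : 3 * n = 1 := by exact_mod_cast h2
    omega
  have h2 : ω ^ 2 = -1 - ω := by
    have : (ω - 1) * (ω ^ 2 + ω + 1) = 0 := by linear_combination h3
    rcases mul_eq_zero.mp this with h | h
    · exact absurd (sub_eq_zero.mp h) hne
    · linear_combination h
  constructor
  · rintro ⟨f, hf, hc⟩
    have hpow : ∀ (n : ℕ) (x : ℂ), (∃ a b : ℤ, x = (1 - ω) * w * ((a : ℂ) + (b : ℂ) * ω)) →
        ∃ a b : ℤ, ω ^ n * x = (1 - ω) * w * ((a : ℂ) + (b : ℂ) * ω) := by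
      intro n x hx
      induction n with
      | zero => simpa using hx
      | succ k ih =>
        obtain ⟨a, b, h⟩ := ih
        refine ⟨-b, a - b, ?_⟩
        push_cast
        linear_combination ω * h + (1 - ω) * w * b * h2
    have key : ∃ n : ℕ, ∃ t : ℂ, (∃ a b : ℤ, t = (1 - ω) * w * ((a : ℂ) + (b : ℂ) * ω)) ∧
        ∀ z, f z = ω ^ n * z + t := by
      clear hc
      induction hf using Subgroup.closure_induction with
      | mem x hx =>
        rcases hx with rfl | hx
        · exact ⟨1, 0, ⟨0, 0, by simp⟩, fun z => by rw [h0]; ring⟩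
        · rw [Set.mem_singleton_iff] at hx
          subst hx
          exact ⟨1, (1 - ω) * w, ⟨1, 0, by simp⟩, fun z => by rw [hw]; ring⟩
      | one => exact ⟨0, 0, ⟨0, 0, by simp⟩, fun z => by simp⟩
      | mul x y _ _ hx hy =>
        obtain ⟨n, t, ht, hx⟩ := hx
        obtain ⟨m, s, hs, hy⟩ := hy
        obtain ⟨a, b, hab⟩ := hpow n s hs
        obtain ⟨a', b', hab'⟩ := ht
        refine ⟨n + m, ω ^ n * s + t, ⟨a + a', b + b', ?_⟩, fun z => ?_⟩
        · push_cast
          linear_combination hab + hab'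
        · rw [IsometryEquiv.mul_apply, hx, hy]
          ring
      | inv x _ hx =>
        obtain ⟨n, t, ht, hx⟩ := hx
        obtain ⟨a, b, hab⟩ := hpow (2 * n) t ht
        have h3n : ω ^ (2 * n) * ω ^ n = 1 := by
          rw [← pow_add, show 2 * n + n = 3 * n by ring, pow_mul, h3, one_pow]
        refine ⟨2 * n, -(ω ^ (2 * n) * t), ⟨-a, -b, ?_⟩, fun z => ?_⟩
        · push_cast
          linear_combination -hab
        · apply x.injective
          rw [IsometryEquiv.apply_inv_self, hx]
          linear_combination (t - z) * h3n
    obtain ⟨n, t, ht, hz⟩ := key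
    have := hz 0
    rw [hc] at this
    simp only [zero_add, mul_zero] at this
    rw [this]
    exact ht
  · rintro ⟨a, b, rfl⟩
    let A : AddSubgroup ℂ :=
      { carrier := {c | ∃ f ∈ Subgroup.closure {ρ0, ρw}, ∀ z : ℂ, f z = z + c}
        zero_mem' := ⟨1, one_mem _, fun z => by simp⟩
        add_mem' := by
          rintro x y ⟨f, hf, hfx⟩ ⟨g, hg, hgy⟩
          refine ⟨f * g, mul_mem hf hg, fun z => ?_⟩
          rw [IsometryEquiv.mul_apply, hfx, hgy]
          ring
        neg_mem' := by
          rintro x ⟨f, hf, hfx⟩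
          refine ⟨f⁻¹, inv_mem hf, fun z => ?_⟩
          apply f.injective
          rw [IsometryEquiv.apply_inv_self, hfx]
          ring }
    have m0 : ρ0 ∈ Subgroup.closure {ρ0, ρw} := Subgroup.subset_closure (by simp)
    have mw : ρw ∈ Subgroup.closure {ρ0, ρw} := Subgroup.subset_closure (by simp)
    have hinv : ∀ z, ρ0⁻¹ z = ω ^ 2 * z := by
      intro z
      apply ρ0.injective
      rw [IsometryEquiv.apply_inv_self, h0]
      linear_combination (-z) * h3
    have hT : (1 - ω) * w ∈ A := by
      refine ⟨ρw * ρ0⁻¹, mul_mem mw (inv_mem m0), fun z => ?_⟩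
      rw [IsometryEquiv.mul_apply, hinv, hw]
      linear_combination z * h3
    have hS : (1 - ω) * w * ω ∈ A := by
      refine ⟨ρ0 * (ρw * ρ0⁻¹) * ρ0⁻¹,
        mul_mem (mul_mem m0 (mul_mem mw (inv_mem m0))) (inv_mem m0), fun z => ?_⟩
      simp only [IsometryEquiv.mul_apply, hinv, hw, h0]
      linear_combination z * (ω ^ 3 + 1) * h3
    have h := A.add_mem (A.zsmul_mem hT a) (A.zsmul_mem hS b)
    have e : (1 - ω) * w * ((a : ℂ) + (b : ℂ) * ω) =
        a • ((1 - ω) * w) + b • ((1 - ω) * w * ω) := by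
      simp only [zsmul_eq_mul]
      ring
    rw [e]
    exact h
end

section
/- Let ζ = exp(iπ/3) and let Λ = {a + b·ζ : a, b ∈ ℤ} ⊆ ℂ. The rotation z ↦ ζ·z of ℂ by π/3 about the origin is not an element of the subgroup of the isometry group of ℂ generated by the reflections across all lines {p + t·d : t ∈ ℝ} with p ∈ Λ and d ∈ {1, ζ, ζ²}. -/
open Complex

/-- **Theorem 5 (key fact).** The π/3-rotation `z ↦ ζ z` about the origin
(`ζ = exp(iπ/3)`) does not belong to the subgroup of the isometry group of `ℂ`
generated by the reflections across the lines `{p + t d : t ∈ ℝ}` with `p` in the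
triangular lattice `Λ = ℤ + ℤζ` and direction `d ∈ {1, ζ, ζ²}` (the reflection across
the line through `p` with direction `d` being the map
`z ↦ p + (d / conj d) · conj (z - p)`). -/
theorem rotation_not_mem_p3m1_reflection_closure
    (ζ : ℂ) (hζ : ζ = Complex.exp (Real.pi / 3 * I))
    (Λ : Set ℂ) (hΛ : Λ = {z : ℂ | ∃ a b : ℤ, z = (a : ℂ) + (b : ℂ) * ζ})
    (S : Set (ℂ ≃ᵢ ℂ))
    (hS : S = {f : ℂ ≃ᵢ ℂ | ∃ p ∈ Λ, ∃ d ∈ ({1, ζ, ζ ^ 2} : Set ℂ),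
        ∀ z : ℂ, f z = p + d / (starRingEnd ℂ) d * (starRingEnd ℂ) (z - p)})
    (r : ℂ ≃ᵢ ℂ) (hr : ∀ z : ℂ, r z = ζ * z) :
    r ∉ Subgroup.closure S := by
  have h3 : ζ ^ 3 = -1 := by
    rw [hζ, ← Complex.exp_nat_mul, ← Complex.exp_pi_mul_I]
    congr 1
    push_cast
    ring
  have hc3 : (starRingEnd ℂ) ζ ^ 3 = -1 := by
    rw [← map_pow, h3]; simp
  have key : ∀ f ∈ Subgroup.closure S,
      (∀ z w, (f z - f w) ^ 3 = (z - w) ^ 3) ∨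
      (∀ z w, (f z - f w) ^ 3 = (starRingEnd ℂ) ((z - w) ^ 3)) := by
    intro f hf
    induction hf using Subgroup.closure_induction with
    | mem f hf =>
      right
      rw [hS] at hf
      obtain ⟨p, -, d, hd, h⟩ := hf
      have hu : (d / (starRingEnd ℂ) d) ^ 3 = 1 := by
        rw [div_pow]
        rcases hd with rfl | rfl | rfl
        · simp
        · rw [h3, hc3]; norm_num
        · rw [map_pow, ← pow_mul, ← pow_mul, mul_comm 2 3, pow_mul, pow_mul, h3, hc3]
          norm_num
      intro z w
      rw [h, h]
      have : p + d / (starRingEnd ℂ) d * (starRingEnd ℂ) (z - p)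
          - (p + d / (starRingEnd ℂ) d * (starRingEnd ℂ) (w - p))
          = d / (starRingEnd ℂ) d * (starRingEnd ℂ) (z - w) := by
        simp only [map_sub]; ring
      rw [this, mul_pow, hu, one_mul, map_pow]
    | one => left; intro z w; rfl
    | mul f g _ _ hf hg =>
      rcases hf with hf | hf <;> rcases hg with hg | hg
      · left; intro z w; exact (hf _ _).trans (hg _ _)
      · right; intro z w; exact (hf _ _).trans (hg _ _)
      · right; intro z w; exact (hf _ _).trans (congrArg _ (hg _ _))
      · left; intro z w
        refine (hf _ _).trans ((congrArg _ (hg _ _)).trans ?_)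
        simp
    | inv f _ hf =>
      have hi : ∀ z, f (f⁻¹ z) = z := fun z => f.apply_symm_apply z
      rcases hf with hf | hf
      · left; intro z w
        rw [← hf, hi, hi]
      · right; intro z w
        have := hf (f⁻¹ z) (f⁻¹ w)
        rw [hi, hi] at this
        rw [this, Complex.conj_conj]
  intro hmem
  have h1 : ζ ^ 3 = 1 := by
    rcases key r hmem with h | h <;> simpa [hr] using h 1 0
  rw [h3] at h1
  norm_num at h1
end

section
/- Let ζ = exp(iπ/3) and Λ = {a + b·ζ : a, b ∈ ℤ} ⊆ ℂ. For p ∈ Λ let U(p) be the closed triangle with vertices p, p + 1, p + ζ and let D(p) be the closed triangle with vertices p + 1, p + ζ, p + 1 + ζ. There is no nonempty finite family of such triangles whose union has interior disjoint from every vertical line {z ∈ ℂ : Re z = j/2} with j ∈ ℤ. Indeed, for every p ∈ Λ, the interiors of U(p) and of D(p) each meet one of these lines. -/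
open Complex Set

lemma centroid_mem_interior (ζ : ℂ) (r : ℝ) (hr : 0 < r) (h1 : ζ.re = 1 / 2) (h2 : ζ.im = r)
    (q : ℂ) (e : ℝ) (he : e * e = 1) :
    q + e * ((1 + ζ) / 3) ∈ interior (convexHull ℝ {q, q + e, q + e * ζ}) := by
  rw [mem_interior]
  refine ⟨{z : ℂ | 0 < e * ((z.im - q.im) / r) ∧
      0 < e * ((z.re - q.re) - ((z.im - q.im) / r) / 2) ∧
      e * ((z.re - q.re) + ((z.im - q.im) / r) / 2) < 1}, ?_, ?_, ?_⟩
  · rintro z ⟨ha, hb, hc⟩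
    obtain ⟨t, ht⟩ : ∃ t, t = (z.im - q.im) / r := ⟨_, rfl⟩
    rw [← ht] at ha hb hc
    have hz : z.im - q.im = t * r := by rw [ht]; field_simp
    have hcv := (convex_convexHull ℝ ({q, q + e, q + e * ζ} : Set ℂ))
    have key := hcv.sum_mem (t := Finset.univ)
      (w := ![1 - e * ((z.re - q.re) + t / 2), e * ((z.re - q.re) - t / 2), e * t])
      (z := ![q, q + e, q + e * ζ])
      (by intro i _; fin_cases i <;> simp <;> linarith)
      (by simp [Fin.sum_univ_three]; ring)
      (by intro i _; apply subset_convexHull; fin_cases i <;> simp)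
    convert key using 1
    simp only [Fin.sum_univ_three]
    apply Complex.ext
    · simp [h1]
      linear_combination (-(z.re - q.re)) * he
    · simp [h2]
      linear_combination hz - t * r * he
  · have o1 : IsOpen {z : ℂ | 0 < e * ((z.im - q.im) / r)} :=
      isOpen_lt (by fun_prop) (by fun_prop)
    have o2 : IsOpen {z : ℂ | 0 < e * ((z.re - q.re) - ((z.im - q.im) / r) / 2)} :=
      isOpen_lt (by fun_prop) (by fun_prop)
    have o3 : IsOpen {z : ℂ | e * ((z.re - q.re) + ((z.im - q.im) / r) / 2) < 1} :=
      isOpen_lt (by fun_prop) (by fun_prop)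
    exact o1.inter (o2.inter o3)
  · have hre : (q + e * ((1 + ζ) / 3)).re - q.re = e / 2 := by
      simp [h1]; ring
    have him : ((q + e * ((1 + ζ) / 3)).im - q.im) / r = e / 3 := by
      simp [h2]; field_simp
    simp only [mem_ofPred_eq, hre, him]
    refine ⟨?_, ?_, ?_⟩ <;> nlinarith

/-- **Theorem 6 (geometric content).** With `ζ = exp(iπ/3)`, `Λ = ℤ + ℤζ` the
triangular lattice, `U p` the closed unit triangle with vertices `p, p+1, p+ζ` and
`D p` the one with vertices `p+1, p+ζ, p+1+ζ`: no nonempty finite family of such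
triangles has the interior of its union disjoint from all vertical lines
`Re z = j/2` (`j ∈ ℤ`); indeed the interiors of `U p` and of `D p` each meet one of
these lines. -/
theorem no_polyiamond_avoids_vertical_axes
    (ζ : ℂ) (hζ : ζ = Complex.exp (Real.pi / 3 * I))
    (Λ : Set ℂ) (hΛ : Λ = {z : ℂ | ∃ a b : ℤ, z = (a : ℂ) + (b : ℂ) * ζ})
    (U D : ℂ → Set ℂ)
    (hU : ∀ p : ℂ, U p = convexHull ℝ {p, p + 1, p + ζ})
    (hD : ∀ p : ℂ, D p = convexHull ℝ {p + 1, p + ζ, p + 1 + ζ}) :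
    (¬ ∃ F : Finset (Set ℂ), F.Nonempty ∧
        (∀ t ∈ F, ∃ p ∈ Λ, t = U p ∨ t = D p) ∧
        ∀ j : ℤ, Disjoint (interior (⋃ t ∈ F, t)) {z : ℂ | z.re = (j : ℝ) / 2}) ∧
      ∀ p ∈ Λ,
        (∃ j : ℤ, (interior (U p) ∩ {z : ℂ | z.re = (j : ℝ) / 2}).Nonempty) ∧
        (∃ j : ℤ, (interior (D p) ∩ {z : ℂ | z.re = (j : ℝ) / 2}).Nonempty) := by
  have h1 : ζ.re = 1 / 2 := by
    rw [hζ, show (Real.pi / 3 * I : ℂ) = ((Real.pi / 3 : ℝ) : ℂ) * I by push_cast; ring,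
      Complex.exp_ofReal_mul_I_re, Real.cos_pi_div_three]
  have h2 : ζ.im = √3 / 2 := by
    rw [hζ, show (Real.pi / 3 * I : ℂ) = ((Real.pi / 3 : ℝ) : ℂ) * I by push_cast; ring,
      Complex.exp_ofReal_mul_I_im, Real.sin_pi_div_three]
  have hr : 0 < √3 / 2 := by positivity
  have main : ∀ p ∈ Λ,
        (∃ j : ℤ, (interior (U p) ∩ {z : ℂ | z.re = (j : ℝ) / 2}).Nonempty) ∧
        (∃ j : ℤ, (interior (D p) ∩ {z : ℂ | z.re = (j : ℝ) / 2}).Nonempty) := by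
    intro p hp
    rw [hΛ] at hp
    obtain ⟨a, b, rfl⟩ := hp
    set p : ℂ := (a : ℂ) + (b : ℂ) * ζ with hpdef
    have hpre : p.re = a + b / 2 := by simp [hpdef, h1]; ring
    constructor
    · have h := centroid_mem_interior ζ _ hr h1 h2 p 1 (by norm_num)
      refine ⟨2 * a + b + 1, p + ((1 : ℝ) : ℂ) * ((1 + ζ) / 3), ?_, ?_⟩
      · rw [hU]
        simpa using h
      · simp only [mem_ofPred_eq]
        simp [hpre, h1]
        ring
    · have h := centroid_mem_interior ζ _ hr h1 h2 (p + 1 + ζ) (-1) (by norm_num)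
      refine ⟨2 * a + b + 2, (p + 1 + ζ) + ((-1 : ℝ) : ℂ) * ((1 + ζ) / 3), ?_, ?_⟩
      · rw [hD]
        convert h using 3
        ext z
        have e1 : p + 1 + ζ + ((-1 : ℝ) : ℂ) = p + ζ := by push_cast; ring
        have e2 : p + 1 + ζ + ((-1 : ℝ) : ℂ) * ζ = p + 1 := by push_cast; ring
        rw [e1, e2]
        simp only [mem_insert_iff, mem_singleton_iff]
        tauto
      · simp only [mem_ofPred_eq]
        simp [hpre, h1]
        ring
  refine ⟨?_, main⟩
  rintro ⟨F, ⟨t, ht⟩, hF, hdis⟩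
  have hsub : interior t ⊆ interior (⋃ t ∈ F, t) :=
    interior_mono (subset_biUnion_of_mem (u := fun t : Set ℂ => t) ht)
  obtain ⟨p, hp, rfl | rfl⟩ := hF t ht
  · obtain ⟨j, z, hz, hj⟩ := (main p hp).1
    exact Set.disjoint_left.1 (hdis j) (hsub hz) hj
  · obtain ⟨j, z, hz, hj⟩ := (main p hp).2
    exact Set.disjoint_left.1 (hdis j) (hsub hz) hj
end
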